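/- Let G be a graph and let α, β, γ be forms on G that are closed, i.e., dα = dβ = dγ = 0. Then the wedge product is associative on them: (α ∧ β) ∧ γ = α ∧ (β ∧ γ). -/

import Mathlib

/-!
Discrete exterior differential calculus on (simple) graphs, following Shi–Yu.

* A tuple of vertices is a *clique tuple* if its entries are pairwise adjacent
  (hence pairwise distinct, since the graph is simple).
* A `k`-tensor is a real function of `k+1` vertex variables vanishing off
  `(k+1)`-cliques; a `k`-form is a skew-symmetric `k`-tensor.
* `tensorProd` is the tensor product, `skewSym` the skew-symmetrization,
  `wedge` the wedge product `α ∧ β = 𝒜(α ⊗ β)`, and `extD` the exterior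
  differential.
-/

open Finset

attribute [local instance] Classical.propDecidable

noncomputable section

variable {V : Type*}

/-- `v₀, …, v_{n-1}` form an `n`-clique of `G` (pairwise adjacent, hence distinct). -/
def IsCliqueTuple (G : SimpleGraph V) {n : ℕ} (v : Fin n → V) : Prop :=
  ∀ i j : Fin n, i ≠ j → G.Adj (v i) (v j)

/-- A `k`-tensor on `G`: a function of `k+1` vertex variables vanishing whenever the
arguments do not form a `(k+1)`-clique. -/
def IsTensor (G : SimpleGraph V) (k : ℕ) (f : (Fin (k + 1) → V) → ℝ) : Prop :=
  ∀ v : Fin (k + 1) → V, ¬ IsCliqueTuple G v → f v = 0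

/-- A `k`-form on `G`: a `k`-tensor that is skew-symmetric in all of its variables. -/
def IsForm (G : SimpleGraph V) (k : ℕ) (f : (Fin (k + 1) → V) → ℝ) : Prop :=
  IsTensor G k f ∧
    ∀ (σ : Equiv.Perm (Fin (k + 1))) (v : Fin (k + 1) → V),
      f (fun i => v (σ i)) = ((Equiv.Perm.sign σ : ℤ) : ℝ) * f v

/-- Tensor product of an `r`-tensor and an `s`-tensor:
`(α ⊗ β)(v₀,…,v_{r+s}) = α(v₀,…,v_r) β(v_r,…,v_{r+s})` on `(r+s+1)`-cliques, `0` otherwise. -/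
def tensorProd (G : SimpleGraph V) (r s : ℕ)
    (α : (Fin (r + 1) → V) → ℝ) (β : (Fin (s + 1) → V) → ℝ) :
    (Fin (r + s + 1) → V) → ℝ :=
  fun v =>
    if IsCliqueTuple G v then
      α (fun i => v (Fin.castLE (by omega) i)) * β (fun i => v ⟨r + i, by omega⟩)
    else 0

/-- Skew-symmetrization of a `k`-tensor:
`𝒜(f)(v₀,…,v_k) = (1/(k+1)!) ∑_{σ ∈ S_{k+1}} sgn σ · f(v_{σ(0)},…,v_{σ(k)})`. -/
def skewSym (k : ℕ) (f : (Fin (k + 1) → V) → ℝ) : (Fin (k + 1) → V) → ℝ :=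
  fun v =>
    ((k + 1).factorial : ℝ)⁻¹ *
      ∑ σ : Equiv.Perm (Fin (k + 1)), ((Equiv.Perm.sign σ : ℤ) : ℝ) * f (fun i => v (σ i))

/-- Wedge product of an `r`-form and an `s`-form: `α ∧ β = 𝒜(α ⊗ β)`. -/
def wedge (G : SimpleGraph V) (r s : ℕ)
    (α : (Fin (r + 1) → V) → ℝ) (β : (Fin (s + 1) → V) → ℝ) :
    (Fin (r + s + 1) → V) → ℝ :=
  skewSym (r + s) (tensorProd G r s α β)

/-- Exterior differential of an `r`-form:
`dα(v₀,…,v_{r+1}) = ∑ᵢ (-1)ⁱ α(v₀,…,v̂ᵢ,…,v_{r+1})` on `(r+2)`-cliques, `0` otherwise.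
For a `0`-form `f` this gives `df(u,v) = f(v) - f(u)` on edges. -/
def extD (G : SimpleGraph V) (r : ℕ) (α : (Fin (r + 1) → V) → ℝ) :
    (Fin (r + 2) → V) → ℝ :=
  fun v =>
    if IsCliqueTuple G v then
      ∑ i : Fin (r + 2), (-1 : ℝ) ^ (i : ℕ) * α (fun j => v (i.succAbove j))
    else 0

/-- Transport a function of `m` vertex variables along an equality `m = n` of arities. -/
def reindex {m n : ℕ} (h : m = n) (f : (Fin m → V) → ℝ) : (Fin n → V) → ℝ :=
  fun v => f (fun i => v (Fin.cast h i))

/-- Wedge product `f ∧ α` of a `0`-form `f : V → ℝ` with a `k`-form `α`,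
reindexed so that the result is again a function of `k+1` vertex variables. -/
def wedge0 (G : SimpleGraph V) (k : ℕ) (f : V → ℝ) (α : (Fin (k + 1) → V) → ℝ) :
    (Fin (k + 1) → V) → ℝ :=
  reindex (by omega) (wedge G 0 k (fun t => f (t 0)) α)

/-- The characteristic `0`-form `χ^v` of a vertex, as a function of one vertex variable. -/
def chi1 (v : V) : (Fin 1 → V) → ℝ := fun t => if t 0 = v then 1 else 0

/-- The `1`-form `dχ^v`. -/
def dchi (G : SimpleGraph V) (v : V) : (Fin 2 → V) → ℝ :=
  extD G 0 (chi1 v)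

/-- The iterated (left-associated) wedge `dχ^{v₁} ∧ dχ^{v₂} ∧ ⋯ ∧ dχ^{v_k}`,
a `k`-form; the empty wedge (`k = 0`) is the constant `1`. -/
def dchiWedge (G : SimpleGraph V) : ∀ k : ℕ, (Fin k → V) → (Fin (k + 1) → V) → ℝ
  | 0, _ => fun _ => 1
  | 1, vs => dchi G (vs 0)
  | (k + 2), vs =>
      wedge G (k + 1) 1 (dchiWedge G (k + 1) (fun i => vs i.castSucc))
        (dchi G (vs (Fin.last (k + 1))))

open Equiv.Perm AlternatingMap

section Perm

variable {ι κ : Type*} [Fintype ι] [DecidableEq ι] [Fintype κ] [DecidableEq κ]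

/-- Antisymmetrizing first over permutations of a subset of the positions does not change the
full antisymmetrization, up to the number of those permutations. -/
theorem sum_sign_mul_sum_viaFintypeEmbedding (e : κ ↪ ι) (g : Equiv.Perm ι → ℝ) :
    ∑ σ : Equiv.Perm ι, ((sign σ : ℤ) : ℝ) *
        ∑ τ : Equiv.Perm κ, ((sign τ : ℤ) : ℝ) * g (σ * τ.viaFintypeEmbedding e) =
      ((Fintype.card κ).factorial : ℝ) * ∑ σ : Equiv.Perm ι, ((sign σ : ℤ) : ℝ) * g σ := by
  simp_rw [Finset.mul_sum]
  rw [Finset.sum_comm]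
  have key : ∀ τ : Equiv.Perm κ,
      ∑ σ : Equiv.Perm ι, ((sign σ : ℤ) : ℝ) *
        (((sign τ : ℤ) : ℝ) * g (σ * τ.viaFintypeEmbedding e)) =
      ∑ σ : Equiv.Perm ι, ((sign σ : ℤ) : ℝ) * g σ := by
    intro τ
    refine Fintype.sum_equiv (Equiv.mulRight (τ.viaFintypeEmbedding e)) _ _ fun σ => ?_
    simp only [Equiv.coe_mulRight, Equiv.Perm.sign_mul, Equiv.Perm.viaFintypeEmbedding_sign]
    push_cast
    ring
  rw [Finset.sum_congr rfl fun τ _ => key τ, Finset.sum_const, Finset.card_univ,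
    Fintype.card_perm, nsmul_eq_mul, Finset.mul_sum]

end Perm

section Alternating

variable {M : Type*} [AddCommGroup M] [Module ℝ M]

/-- An alternating map is unchanged when one argument is subtracted from all the others. -/
theorem AlternatingMap.map_sub_apply_of_ne {ι : Type*} [Fintype ι] [DecidableEq ι]
    (F : M [⋀^ι]→ₗ[ℝ] ℝ) (y : ι → M) (m : ι) :
    F (fun i => if i = m then y m else y i - y m) = F y := by
  have key : ∀ s : Finset ι, m ∉ s → F (fun i => if i ∈ s then y i - y m else y i) = F y := by
    intro s
    induction s using Finset.induction_on with
    | empty => simp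
    | insert a s ha ih =>
      intro hm
      rw [Finset.mem_insert, not_or] at hm
      set z : ι → M := fun i => if i ∈ s then y i - y m else y i with hz
      have h1 : (fun i => if i ∈ insert a s then y i - y m else y i)
          = Function.update z a (y a - y m) := by
        funext i
        by_cases hi : i = a
        · subst hi; simp
        · simp [hi, hz]
      have h2 : Function.update z a (y a) = z := by
        rw [Function.update_eq_self_iff]; simp [hz, ha]
      have h3 : F (Function.update z a (y m)) = 0 := by
        refine F.map_eq_zero_of_eq _ (i := a) (j := m) ?_ (Ne.symm hm.1)
        simp [hm.1, hz, hm.2]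
      rw [h1, F.map_update_sub, h2, h3, sub_zero, ih hm.2]
  rw [← key (Finset.univ.erase m) (by simp)]
  congr 1
  funext i
  by_cases hi : i = m <;> simp [hi]

/-- The wedge of a linear functional with an alternating map. -/
def coneForm (e : M →ₗ[ℝ] ℝ) {n : ℕ} (A : M [⋀^Fin n]→ₗ[ℝ] ℝ) : M [⋀^Fin (n + 1)]→ₗ[ℝ] ℝ :=
  alternatizeUncurryFin (e.smulRight A)

theorem coneForm_apply (e : M →ₗ[ℝ] ℝ) {n : ℕ} (A : M [⋀^Fin n]→ₗ[ℝ] ℝ)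
    (y : Fin (n + 1) → M) :
    coneForm e A y = ∑ i : Fin (n + 1), (-1 : ℝ) ^ (i : ℕ) *
      (e (y i) * A (fun j => y (i.succAbove j))) := by
  rw [coneForm, alternatizeUncurryFin_apply]
  refine Finset.sum_congr rfl fun i _ => ?_
  have : (i.removeNth y) = fun j => y (i.succAbove j) := rfl
  simp [this, zsmul_eq_mul]

/-- On the affine hyperplane `e = 1`, the form `coneForm e A` is computed from differences
to any one of the arguments. -/
theorem coneForm_apply_of_eq_one (e : M →ₗ[ℝ] ℝ) {n : ℕ} (A : M [⋀^Fin n]→ₗ[ℝ] ℝ)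
    (y : Fin (n + 1) → M) (hy : ∀ i, e (y i) = 1) (m : Fin (n + 1)) :
    coneForm e A y =
      (-1 : ℝ) ^ (m : ℕ) * A (fun j => y (m.succAbove j) - y m) := by
  rw [← (coneForm e A).map_sub_apply_of_ne y m, coneForm_apply,
    Fintype.sum_eq_single m]
  · simp [hy, Fin.succAbove_ne]
  · intro i hi
    simp [hi, hy]

/-- The ordinary tensor product of two multilinear forms. -/
def tensorForm {r s : ℕ} (A : M [⋀^Fin r]→ₗ[ℝ] ℝ) (B : M [⋀^Fin s]→ₗ[ℝ] ℝ) :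
    MultilinearMap ℝ (fun _ : Fin (r + s) => M) ℝ :=
  ((LinearMap.mul' ℝ ℝ).compMultilinearMap
    (A.toMultilinearMap.domCoprod B.toMultilinearMap)).domDomCongr finSumFinEquiv

theorem tensorForm_apply {r s : ℕ} (A : M [⋀^Fin r]→ₗ[ℝ] ℝ) (B : M [⋀^Fin s]→ₗ[ℝ] ℝ)
    (z : Fin (r + s) → M) :
    tensorForm A B z = A (fun i => z (Fin.castAdd s i)) * B (fun i => z (Fin.natAdd r i)) := by
  simp [tensorForm]

/-- The antisymmetrized tensor product of two alternating forms, normalized as a projection. -/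
def altProd {r s : ℕ} (A : M [⋀^Fin r]→ₗ[ℝ] ℝ) (B : M [⋀^Fin s]→ₗ[ℝ] ℝ) :
    M [⋀^Fin (r + s)]→ₗ[ℝ] ℝ :=
  ((r + s).factorial : ℝ)⁻¹ • MultilinearMap.alternatization (tensorForm A B)

theorem altProd_apply {r s : ℕ} (A : M [⋀^Fin r]→ₗ[ℝ] ℝ) (B : M [⋀^Fin s]→ₗ[ℝ] ℝ)
    (z : Fin (r + s) → M) :
    altProd A B z = ((r + s).factorial : ℝ)⁻¹ * ∑ σ : Equiv.Perm (Fin (r + s)),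
      ((sign σ : ℤ) : ℝ) * (A (fun i => z (σ (Fin.castAdd s i))) *
        B (fun i => z (σ (Fin.natAdd r i)))) := by
  rw [altProd, AlternatingMap.smul_apply, MultilinearMap.alternatization_apply, smul_eq_mul]
  congr 1
  refine Finset.sum_congr (by congr!) fun σ _ => ?_
  simp only [MultilinearMap.domDomCongr_apply, tensorForm_apply, Units.smul_def, zsmul_eq_mul]

theorem altProd_altProd_left {r s t : ℕ} (A : M [⋀^Fin r]→ₗ[ℝ] ℝ) (B : M [⋀^Fin s]→ₗ[ℝ] ℝ)
    (C : M [⋀^Fin t]→ₗ[ℝ] ℝ) (z : Fin (r + s + t) → M) :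
    altProd (altProd A B) C z = ((r + s + t).factorial : ℝ)⁻¹ *
      ∑ σ : Equiv.Perm (Fin (r + s + t)), ((sign σ : ℤ) : ℝ) *
        (A (fun i => z (σ (Fin.castAdd t (Fin.castAdd s i)))) *
          B (fun i => z (σ (Fin.castAdd t (Fin.natAdd r i)))) *
          C (fun i => z (σ (Fin.natAdd (r + s) i)))) := by
  have hf : ((r + s).factorial : ℝ) ≠ 0 := by positivity
  rw [altProd_apply]
  congr 1
  rw [← mul_right_inj' hf]
  have := sum_sign_mul_sum_viaFintypeEmbedding (Fin.castAddEmb t : Fin (r + s) ↪ Fin (r + s + t))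
    (fun σ => A (fun i => z (σ (Fin.castAdd t (Fin.castAdd s i)))) *
          B (fun i => z (σ (Fin.castAdd t (Fin.natAdd r i)))) *
          C (fun i => z (σ (Fin.natAdd (r + s) i))))
  rw [Fintype.card_fin] at this
  rw [← this, Finset.mul_sum]
  refine Finset.sum_congr rfl fun σ _ => ?_
  rw [altProd_apply, mul_left_comm]
  congr 1
  rw [← mul_assoc, mul_inv_cancel_left₀ hf, Finset.sum_mul]
  refine Finset.sum_congr rfl fun τ _ => ?_
  have h1 : ∀ i, (τ.viaFintypeEmbedding (Fin.castAddEmb t)) (Fin.castAdd t i) =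
      Fin.castAdd t (τ i) := fun i => τ.viaFintypeEmbedding_apply_image (Fin.castAddEmb t) i
  have h2 : ∀ i, (τ.viaFintypeEmbedding (Fin.castAddEmb t)) (Fin.natAdd (r + s) i) =
      Fin.natAdd (r + s) i := fun i => by
    apply Equiv.Perm.viaFintypeEmbedding_apply_notMem_range
    rintro ⟨j, hj⟩
    have := congrArg Fin.val hj
    simp at this
    omega
  simp only [Equiv.Perm.mul_apply, h1, h2, mul_assoc]

theorem altProd_altProd_right {r s t : ℕ} (A : M [⋀^Fin r]→ₗ[ℝ] ℝ) (B : M [⋀^Fin s]→ₗ[ℝ] ℝ)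
    (C : M [⋀^Fin t]→ₗ[ℝ] ℝ) (z : Fin (r + (s + t)) → M) :
    altProd A (altProd B C) z = ((r + (s + t)).factorial : ℝ)⁻¹ *
      ∑ σ : Equiv.Perm (Fin (r + (s + t))), ((sign σ : ℤ) : ℝ) *
        (A (fun i => z (σ (Fin.castAdd (s + t) i))) *
          B (fun i => z (σ (Fin.natAdd r (Fin.castAdd t i)))) *
          C (fun i => z (σ (Fin.natAdd r (Fin.natAdd s i))))) := by
  have hf : ((s + t).factorial : ℝ) ≠ 0 := by positivity
  rw [altProd_apply]
  congr 1
  rw [← mul_right_inj' hf]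
  have := sum_sign_mul_sum_viaFintypeEmbedding (Fin.natAddEmb r : Fin (s + t) ↪ Fin (r + (s + t)))
    (fun σ => A (fun i => z (σ (Fin.castAdd (s + t) i))) *
          B (fun i => z (σ (Fin.natAdd r (Fin.castAdd t i)))) *
          C (fun i => z (σ (Fin.natAdd r (Fin.natAdd s i)))))
  rw [Fintype.card_fin] at this
  rw [← this, Finset.mul_sum]
  refine Finset.sum_congr rfl fun σ _ => ?_
  rw [altProd_apply, mul_left_comm]
  congr 1
  rw [mul_left_comm _ (A _), mul_inv_cancel_left₀ hf, Finset.mul_sum]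
  refine Finset.sum_congr rfl fun τ _ => ?_
  have h1 : ∀ i, (τ.viaFintypeEmbedding (Fin.natAddEmb r)) (Fin.natAdd r i) =
      Fin.natAdd r (τ i) := fun i => τ.viaFintypeEmbedding_apply_image (Fin.natAddEmb r) i
  have h2 : ∀ i, (τ.viaFintypeEmbedding (Fin.natAddEmb r)) (Fin.castAdd (s + t) i) =
      Fin.castAdd (s + t) i := fun i => by
    apply Equiv.Perm.viaFintypeEmbedding_apply_notMem_range
    rintro ⟨j, hj⟩
    have := congrArg Fin.val hj
    simp at this
    omega
  simp only [Equiv.Perm.mul_apply, h1, h2]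
  ring

theorem altProd_assoc {r s t : ℕ} (A : M [⋀^Fin r]→ₗ[ℝ] ℝ) (B : M [⋀^Fin s]→ₗ[ℝ] ℝ)
    (C : M [⋀^Fin t]→ₗ[ℝ] ℝ) (h : r + (s + t) = r + s + t) (z : Fin (r + s + t) → M) :
    altProd (altProd A B) C z = altProd A (altProd B C) (fun i => z (Fin.cast h i)) := by
  rw [altProd_altProd_left, altProd_altProd_right]
  congr 1
  · rw [h]
  refine Fintype.sum_equiv (finCongr h).symm.permCongr _ _ fun σ => ?_
  rw [Equiv.Perm.sign_permCongr]
  simp only [Equiv.permCongr_apply, finCongr_symm, finCongr_apply,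
    Fin.cast_cast, Fin.cast_eq_self]
  congr!
  all_goals first | rfl | (ext; simp [add_assoc])

end Alternating

section Represents

variable {N : ℕ}

/-- The alternating form on `ℝ^N` with prescribed skew-symmetric values on basis vectors. -/
theorem exists_alternatingMap_apply_single {n : ℕ} (f : (Fin n → Fin N) → ℝ)
    (hf : ∀ (σ : Equiv.Perm (Fin n)) (u : Fin n → Fin N),
      f (fun i => u (σ i)) = ((sign σ : ℤ) : ℝ) * f u) :
    ∃ A : (Fin N → ℝ) [⋀^Fin n]→ₗ[ℝ] ℝ,
      ∀ u : Fin n → Fin N, A (fun i => Pi.single (u i) 1) = f u := by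
  let m : MultilinearMap ℝ (fun _ : Fin n => Fin N → ℝ) ℝ :=
    ∑ u : Fin n → Fin N, f u • (MultilinearMap.mkPiAlgebra ℝ (Fin n) ℝ).compLinearMap
      (fun i => LinearMap.proj (u i))
  have hm : ∀ u : Fin n → Fin N, m (fun i => Pi.single (u i) 1) = f u := by
    intro u
    simp only [m, _root_.sum_apply, _root_.smul_apply,
      MultilinearMap.compLinearMap_apply, MultilinearMap.mkPiAlgebra_apply, LinearMap.proj_apply,
      smul_eq_mul]
    rw [Fintype.sum_eq_single u]
    · simp
    · intro u' hu'
      obtain ⟨i, hi⟩ := Function.ne_iff.mp hu'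
      rw [Finset.prod_eq_zero (Finset.mem_univ i) (by simp [hi]), mul_zero]
  refine ⟨(n.factorial : ℝ)⁻¹ • MultilinearMap.alternatization m, fun u => ?_⟩
  rw [AlternatingMap.smul_apply, MultilinearMap.alternatization_apply, smul_eq_mul,
    inv_mul_eq_iff_eq_mul₀ (by positivity)]
  have hterm : ∀ σ : Equiv.Perm (Fin n),
      (sign σ • m.domDomCongr σ fun i => Pi.single (u i) (1 : ℝ)) = f u := by
    intro σ
    rw [MultilinearMap.domDomCongr_apply, hm fun i => u (σ i), hf, Units.smul_def, zsmul_eq_mul,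
      ← mul_assoc, ← Int.cast_mul, Int.units_coe_mul_self, Int.cast_one, one_mul]
  trans ∑ σ : Equiv.Perm (Fin n), f u
  · refine Finset.sum_congr (by congr!) fun σ _ => ?_
    rw [← hterm σ]
  · simp [Finset.card_univ, Fintype.card_perm]

/-- The sum of the coordinates. -/
def coordSum (N : ℕ) : (Fin N → ℝ) →ₗ[ℝ] ℝ := ∑ i, LinearMap.proj i

theorem coordSum_single (i : Fin N) : coordSum N (Pi.single i 1) = 1 := by
  simp [coordSum]

/-- On the simplex `v`, the cochain `α` is the restriction to basis vectors of the
alternating form `coordSum ∧ A`. -/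
def Represents {r : ℕ} (α : (Fin (r + 1) → V) → ℝ) (v : Fin N → V)
    (A : (Fin N → ℝ) [⋀^Fin r]→ₗ[ℝ] ℝ) : Prop :=
  ∀ w : Fin (r + 1) → Fin N, Function.Injective w →
    α (fun i => v (w i)) = coneForm (coordSum N) A (fun i => Pi.single (w i) 1)

theorem Represents.eq {r : ℕ} {α : (Fin (r + 1) → V) → ℝ} {v : Fin N → V}
    {A : (Fin N → ℝ) [⋀^Fin r]→ₗ[ℝ] ℝ} (h : Represents α v A) (w : Fin (r + 1) → Fin N)
    (hw : Function.Injective w) (m : Fin (r + 1)) :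
    α (fun i => v (w i)) = (-1 : ℝ) ^ (m : ℕ) *
      A (fun j => Pi.single (w (m.succAbove j)) 1 - Pi.single (w m) 1) := by
  rw [h w hw, coneForm_apply_of_eq_one _ _ _ (fun i => coordSum_single (w i)) m]

theorem IsCliqueTuple.comp {G : SimpleGraph V} {m n : ℕ} {v : Fin n → V}
    (hv : IsCliqueTuple G v) {w : Fin m → Fin n} (hw : Function.Injective w) :
    IsCliqueTuple G (fun i => v (w i)) :=
  fun _ _ hij => hv _ _ (hw.ne hij)

theorem IsCliqueTuple.injective {G : SimpleGraph V} {n : ℕ} {v : Fin n → V}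
    (hv : IsCliqueTuple G v) : Function.Injective v := by
  intro i j hij
  by_contra hne
  exact (hv i j hne).ne hij

/-- The restriction of a closed form to a simplex is represented by its cone over a vertex. -/
theorem exists_represents {G : SimpleGraph V} {r : ℕ} {α : (Fin (r + 1) → V) → ℝ}
    (hα : IsForm G r α) (hc : extD G r α = 0) {v : Fin (N + 1) → V} (hv : IsCliqueTuple G v) :
    ∃ A, Represents α v A := by
  obtain ⟨A, hA⟩ := exists_alternatingMap_apply_single
    (fun u : Fin r → Fin (N + 1) => α (fun i => v ((Fin.cons 0 u : Fin (r + 1) → Fin (N + 1)) i)))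
    (fun σ u => by
      rw [← Equiv.Perm.viaFintypeEmbedding_sign σ (Fin.succEmb r), ← hα.2]
      congr 1
      funext i
      congr 1
      refine Fin.cases ?_ (fun j => ?_) i
      · rw [Equiv.Perm.viaFintypeEmbedding_apply_notMem_range]
        · rfl
        · rintro ⟨j, hj⟩
          exact Fin.succ_ne_zero j hj
      · have : σ.viaFintypeEmbedding (Fin.succEmb r) j.succ = (σ j).succ :=
          σ.viaFintypeEmbedding_apply_image (Fin.succEmb r) j
        rw [this, Fin.cons_succ, Fin.cons_succ])
  refine ⟨A, fun w hw => ?_⟩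
  rw [coneForm_apply]
  simp only [coordSum_single, one_mul, hA fun j => w (Fin.succAbove _ j)]
  by_cases h0 : ∃ k, w k = 0
  · obtain ⟨k, hk⟩ := h0
    rw [Fintype.sum_eq_single k]
    · have hperm := hα.2 k.cycleRange (fun i => v
        ((Fin.cons 0 (fun j => w (k.succAbove j)) : Fin (r + 1) → Fin (N + 1)) i))
      simp only [Fin.cons_apply_cycleRange, Fin.sign_cycleRange] at hperm
      have hins : (k.insertNth 0 (fun j => w (k.succAbove j)) : Fin (r + 1) → Fin (N + 1)) = w := by
        rw [← hk]
        exact Fin.insertNth_self_removeNth k w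
      rw [hins] at hperm
      rw [hperm]
      push_cast
      rfl
    · intro i hi
      obtain ⟨j, hj⟩ := Fin.exists_succAbove_eq hi.symm
      rw [hα.1, mul_zero]
      intro hcl
      refine Fin.succ_ne_zero j (hcl.injective ?_)
      simp [hj, hk]
  · push Not at h0
    have hinj : Function.Injective (Fin.cons 0 w : Fin (r + 2) → Fin (N + 1)) := by
      rw [Fin.cons_injective_iff]
      exact ⟨fun ⟨k, hk⟩ => h0 k hk, hw⟩
    have h := congrFun hc (fun i => v ((Fin.cons 0 w : Fin (r + 2) → Fin (N + 1)) i))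
    rw [extD, if_pos (hv.comp hinj), Fin.sum_univ_succ] at h
    simp only [Fin.val_zero, pow_zero, one_mul, Fin.zero_succAbove, Fin.cons_succ, Fin.val_succ,
      pow_succ, Pi.zero_apply, mul_neg, mul_one, neg_mul, Finset.sum_neg_distrib] at h
    rw [← sub_eq_add_neg, sub_eq_zero] at h
    rw [h]
    refine Finset.sum_congr rfl fun i _ => ?_
    congr 2
    funext j
    congr 1
    refine Fin.cases ?_ (fun j => ?_) j <;> simp

/-- On the affine hyperplane `e = 1`, the form `coneForm e (altProd A B)` is the antisymmetrization
of `A ⊗ B` applied to the differences to the argument in any fixed position. -/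
theorem factorial_mul_coneForm_altProd {M : Type*} [AddCommGroup M] [Module ℝ M]
    (e : M →ₗ[ℝ] ℝ) {r s : ℕ} (A : M [⋀^Fin r]→ₗ[ℝ] ℝ) (B : M [⋀^Fin s]→ₗ[ℝ] ℝ)
    (y : Fin (r + s + 1) → M) (hy : ∀ i, e (y i) = 1) (m : Fin (r + s + 1)) :
    ((r + s + 1).factorial : ℝ) * coneForm e (altProd A B) y =
      ∑ σ : Equiv.Perm (Fin (r + s + 1)), ((sign σ : ℤ) : ℝ) * ((-1 : ℝ) ^ (m : ℕ) *
        (A (fun i => y (σ (m.succAbove (Fin.castAdd s i))) - y (σ m)) *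
          B (fun i => y (σ (m.succAbove (Fin.natAdd r i))) - y (σ m)))) := by
  have hf : ((r + s).factorial : ℝ) ≠ 0 := by positivity
  have h1 : ∀ σ : Equiv.Perm (Fin (r + s + 1)),
      ((sign σ : ℤ) : ℝ) * coneForm e (altProd A B) (fun i => y (σ i)) =
        coneForm e (altProd A B) y := by
    intro σ
    have : coneForm e (altProd A B) (fun i => y (σ i)) =
        ((sign σ : ℤ) : ℝ) * coneForm e (altProd A B) y := by
      have := (coneForm e (altProd A B)).map_perm y σ
      rw [Units.smul_def, zsmul_eq_mul] at this
      exact this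
    rw [this, ← mul_assoc, ← Int.cast_mul, Int.units_coe_mul_self, Int.cast_one, one_mul]
  have h2 : ((r + s + 1).factorial : ℝ) * coneForm e (altProd A B) y =
      ∑ σ : Equiv.Perm (Fin (r + s + 1)),
        ((sign σ : ℤ) : ℝ) * coneForm e (altProd A B) (fun i => y (σ i)) := by
    rw [Finset.sum_congr rfl fun σ _ => h1 σ]
    simp [Finset.card_univ, Fintype.card_perm]
  rw [h2, ← mul_right_inj' hf]
  have := sum_sign_mul_sum_viaFintypeEmbedding m.succAboveEmb
    (fun σ => (-1 : ℝ) ^ (m : ℕ) *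
        (A (fun i => y (σ (m.succAbove (Fin.castAdd s i))) - y (σ m)) *
          B (fun i => y (σ (m.succAbove (Fin.natAdd r i))) - y (σ m))))
  rw [Fintype.card_fin] at this
  rw [← this, Finset.mul_sum]
  refine Finset.sum_congr rfl fun σ _ => ?_
  rw [coneForm_apply_of_eq_one e _ _ (fun i => hy (σ i)) m, altProd_apply, mul_left_comm]
  congr 1
  rw [mul_left_comm _ ((-1 : ℝ) ^ (m : ℕ)), mul_inv_cancel_left₀ hf, Finset.mul_sum]
  refine Finset.sum_congr rfl fun τ _ => ?_
  have h1 : ∀ i, (τ.viaFintypeEmbedding m.succAboveEmb) (m.succAbove i) =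
      m.succAbove (τ i) := fun i => τ.viaFintypeEmbedding_apply_image m.succAboveEmb i
  have h2 : (τ.viaFintypeEmbedding m.succAboveEmb) m = m := by
    apply Equiv.Perm.viaFintypeEmbedding_apply_notMem_range
    rintro ⟨j, hj⟩
    exact Fin.succAbove_ne m j hj
  simp only [Equiv.Perm.mul_apply, h1, h2]
  ring

theorem Represents.wedge {G : SimpleGraph V} {r s : ℕ} {α : (Fin (r + 1) → V) → ℝ}
    {β : (Fin (s + 1) → V) → ℝ} {v : Fin N → V} (hv : IsCliqueTuple G v)
    {A : (Fin N → ℝ) [⋀^Fin r]→ₗ[ℝ] ℝ} {B : (Fin N → ℝ) [⋀^Fin s]→ₗ[ℝ] ℝ}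
    (hA : Represents α v A) (hB : Represents β v B) :
    Represents (_root_.wedge G r s α β) v (altProd A B) := by
  intro w hw
  rw [_root_.wedge, skewSym, inv_mul_eq_iff_eq_mul₀ (by positivity),
    factorial_mul_coneForm_altProd _ _ _ _ (fun i => coordSum_single (w i))
      ⟨r, by omega⟩]
  refine Finset.sum_congr rfl fun σ _ => ?_
  congr 1
  have hinj : Function.Injective fun i => w (σ i) := hw.comp σ.injective
  rw [tensorProd, if_pos (hv.comp hinj),
    hA.eq (fun i : Fin (r + 1) => w (σ (Fin.castLE (by omega : r + 1 ≤ r + s + 1) i)))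
      (hinj.comp (Fin.castLE_injective (by omega))) (Fin.last r),
    hB.eq (fun i : Fin (s + 1) => w (σ ⟨r + i, by omega⟩))
      (hinj.comp fun i j hij => by simpa [Fin.ext_iff] using hij) 0]
  have h1 : ∀ j : Fin r, Fin.castLE (by omega : r + 1 ≤ r + s + 1) j.castSucc =
      (⟨r, by omega⟩ : Fin (r + s + 1)).succAbove (Fin.castAdd s j) := by
    intro j
    rw [Fin.succAbove_of_castSucc_lt _ _ (by simp [Fin.lt_def])]
    rfl
  have h2 : ∀ j : Fin s, (⟨r + (j.succ : Fin (s + 1)), by omega⟩ : Fin (r + s + 1)) =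
      (⟨r, by omega⟩ : Fin (r + s + 1)).succAbove (Fin.natAdd r j) := by
    intro j
    rw [Fin.succAbove_of_le_castSucc _ _ (by simp [Fin.le_def])]
    ext
    simp [add_assoc]
  have h3 : Fin.castLE (by omega : r + 1 ≤ r + s + 1) (Fin.last r) = ⟨r, by omega⟩ := rfl
  simp only [Fin.succAbove_last, Fin.zero_succAbove, h1, h2, h3, Fin.val_last, Fin.val_zero,
    pow_zero, one_mul, add_zero, mul_assoc]

theorem wedge_eq_zero_of_not_isCliqueTuple {G : SimpleGraph V} {r s : ℕ}
    (α : (Fin (r + 1) → V) → ℝ) (β : (Fin (s + 1) → V) → ℝ) {v : Fin (r + s + 1) → V}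
    (hv : ¬ IsCliqueTuple G v) : wedge G r s α β v = 0 := by
  rw [wedge, skewSym, Finset.sum_eq_zero, mul_zero]
  intro σ _
  rw [tensorProd, if_neg, mul_zero]
  intro h
  apply hv
  simpa using h.comp σ.symm.injective

end Represents

/-- Associativity of the wedge product on closed forms:
if `dα = dβ = dγ = 0` then `(α ∧ β) ∧ γ = α ∧ (β ∧ γ)`. -/
theorem wedge_assoc_of_closed (G : SimpleGraph V) (r s t : ℕ)
    (α : (Fin (r + 1) → V) → ℝ) (β : (Fin (s + 1) → V) → ℝ) (γ : (Fin (t + 1) → V) → ℝ)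
    (hα : IsForm G r α) (hβ : IsForm G s β) (hγ : IsForm G t γ)
    (hcα : extD G r α = 0) (hcβ : extD G s β = 0) (hcγ : extD G t γ = 0) :
    wedge G (r + s) t (wedge G r s α β) γ =
      reindex (by omega) (wedge G r (s + t) α (wedge G s t β γ)) := by
  have hN : r + (s + t) = r + s + t := (add_assoc r s t).symm
  funext v
  rw [reindex]
  by_cases hv : IsCliqueTuple G v
  · obtain ⟨A, hA⟩ := exists_represents hα hcα hv
    obtain ⟨B, hB⟩ := exists_represents hβ hcβ hv
    obtain ⟨C, hC⟩ := exists_represents hγ hcγ hv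
    have hl := ((hA.wedge hv hB).wedge hv hC).eq id Function.injective_id 0
    have hr := (hA.wedge hv (hB.wedge hv hC)).eq (Fin.cast (by omega)) (Fin.cast_injective _) 0
    simp only [id] at hl
    rw [hl, hr, altProd_assoc A B C hN]
    rfl
  · rw [wedge_eq_zero_of_not_isCliqueTuple _ _ hv, wedge_eq_zero_of_not_isCliqueTuple]
    intro h
    apply hv
    exact h.comp (Fin.cast_injective (by omega : r + s + t + 1 = r + (s + t) + 1))

end
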